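/- (Theorem 3.1) Assume each ℓ_i is convex and L_i-smooth, σ_*² is finite, and shuffled SGD is run for K epochs with uniformly random shuffling (random reshuffling or shuffle-once) and step sizes satisfying η_k ≤ b/(n√(2 L̂_{π^{(k)}} L̃_{π^{(k)}})). Let H_K = ∑_{k=1}^K η_k and x̂_K = (∑_{k=1}^K η_k x_k)/H_K. Then E[H_K (f(x̂_K) − f(x_*))] ≤ (b/(2n))‖x_0 − x_*‖₂² + ∑_{k=1}^K (η_k³ L̃ (n−b)(n+b))/(6b²(n−1)) · σ_*². -/

import Mathlib

open Finset Matrix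

namespace SSGD

/-- squared Euclidean norm of a finite vector -/
noncomputable def sq {ι : Type*} [Fintype ι] (x : ι → ℝ) : ℝ := ∑ i, (x i) ^ 2

/-- Euclidean dot product -/
noncomputable def dot {ι : Type*} [Fintype ι] (x y : ι → ℝ) : ℝ := ∑ i, x i * y i

/-- weighted squared norm `‖u‖²_{(diag w)⁻¹} = ∑ i, (u i)² / w i` -/
noncomputable def wsq {ι : Type*} [Fintype ι] (w u : ι → ℝ) : ℝ := ∑ i, (u i) ^ 2 / w i

/-- operator (spectral) norm of a real matrix -/
noncomputable def opNorm {α β : Type*} [Fintype α] [Fintype β] [DecidableEq β]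
    (M : Matrix α β ℝ) : ℝ :=
  ‖LinearMap.toContinuousLinearMap (Matrix.toEuclideanLin M)‖

/-- `0`-based global index of the `j`-th element of the `i`-th batch of size `b` -/
def idx (b m : ℕ) (i : Fin m) (j : Fin b) : Fin (b * m) :=
  ⟨b * i.1 + j.1, by
    have hi : i.1 + 1 ≤ m := i.2
    have hj : j.1 < b := j.2
    calc b * i.1 + j.1 < b * i.1 + b := by omega
      _ = b * (i.1 + 1) := by ring
      _ ≤ b * m := Nat.mul_le_mul (le_refl b) hi⟩

/-- `I_{j↑}` : the identity matrix with its first `j` diagonal entries zeroed out -/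
noncomputable def Iup (n j : ℕ) : Matrix (Fin n) (Fin n) ℝ :=
  Matrix.diagonal fun i => if j ≤ i.1 then 1 else 0

/-- `I_{(j)}` (`j` 0-based) : diagonal matrix with ones exactly in positions
`b*j, …, b*(j+1)-1` -/
noncomputable def Iblk (n b j : ℕ) : Matrix (Fin n) (Fin n) ℝ :=
  Matrix.diagonal fun i => if b * j ≤ i.1 ∧ i.1 < b * (j + 1) then 1 else 0

variable {d b m : ℕ}

/-- the row-permuted data matrix `A_π` (row `i` of `A_π` is row `π i` of `A`) -/
def permMat (A : Matrix (Fin (b * m)) (Fin d) ℝ) (π : Equiv.Perm (Fin (b * m))) :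
    Matrix (Fin (b * m)) (Fin d) ℝ :=
  A.submatrix π id

/-- `Ĉ_π = (1/(m·n)) ‖W_π^{1/2} (∑_{j=1}^m I_{b(j-1)↑} A_π A_πᵀ I_{b(j-1)↑}) W_π^{1/2}‖₂`;
this is `L̂_π` for `w = L` and `Ĝ_π` for `w = G²`. -/
noncomputable def hatC (A : Matrix (Fin (b * m)) (Fin d) ℝ) (w : Fin (b * m) → ℝ)
    (π : Equiv.Perm (Fin (b * m))) : ℝ :=
  (1 / ((m : ℝ) * ((b * m : ℕ) : ℝ))) * opNorm
    (Matrix.diagonal (fun i => Real.sqrt (w (π i))) *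
      (∑ j : Fin m,
        Iup (b * m) (b * j.1) * (permMat A π * (permMat A π)ᵀ) * Iup (b * m) (b * j.1)) *
      Matrix.diagonal (fun i => Real.sqrt (w (π i))))

/-- `C̃_π = (1/b) ‖W_π^{1/2} (∑_{j=1}^m I_{(j)} A_π A_πᵀ I_{(j)}) W_π^{1/2}‖₂`;
this is `L̃_π` for `w = L` and `G̃_π` for `w = G²`. -/
noncomputable def tilC (A : Matrix (Fin (b * m)) (Fin d) ℝ) (w : Fin (b * m) → ℝ)
    (π : Equiv.Perm (Fin (b * m))) : ℝ :=
  (1 / (b : ℝ)) * opNorm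
    (Matrix.diagonal (fun i => Real.sqrt (w (π i))) *
      (∑ j : Fin m,
        Iblk (b * m) b j.1 * (permMat A π * (permMat A π)ᵀ) * Iblk (b * m) b j.1) *
      Matrix.diagonal (fun i => Real.sqrt (w (π i))))

/-- one inner (mini-batch) step of shuffled SGD, using the (sub)gradient selection `g` -/
noncomputable def step (A : Matrix (Fin (b * m)) (Fin d) ℝ) (g : Fin (b * m) → ℝ → ℝ)
    (η : ℝ) (π : Equiv.Perm (Fin (b * m))) (i : Fin m) (x : Fin d → ℝ) : Fin d → ℝ :=
  fun t => x t - (η / (b : ℝ)) *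
    ∑ j : Fin b, g (π (idx b m i j)) (dot (A (π (idx b m i j))) x) * A (π (idx b m i j)) t

/-- the primal iterates `x_{k-1,1}, …, x_{k-1,m+1}` within a single epoch
(`inIter A g η π x0 i` is `x_{k-1,i+1}`, so `inIter … 0 = x_{k-1}` and
`inIter … m = x_k`) -/
noncomputable def inIter (A : Matrix (Fin (b * m)) (Fin d) ℝ) (g : Fin (b * m) → ℝ → ℝ)
    (η : ℝ) (π : Equiv.Perm (Fin (b * m))) (x0 : Fin d → ℝ) : ℕ → Fin d → ℝ
  | 0 => x0
  | i + 1 =>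
    if h : i < m then step A g η π ⟨i, h⟩ (inIter A g η π x0 i) else inIter A g η π x0 i

/-- the dual vector `y_k` of one epoch, in permuted coordinates: its `p`-th entry is
`g_{π(p)}(a_{π(p)}ᵀ x_{k-1,i})` where `i` is the batch containing position `p` -/
noncomputable def dualY (A : Matrix (Fin (b * m)) (Fin d) ℝ) (g : Fin (b * m) → ℝ → ℝ)
    (η : ℝ) (π : Equiv.Perm (Fin (b * m))) (x0 : Fin d → ℝ) : Fin (b * m) → ℝ :=
  fun p => g (π p) (dot (A (π p)) (inIter A g η π x0 (p.1 / b)))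

/-- multi-epoch shuffled SGD: `xSeq A g η πs x0 k` is the iterate after `k` full epochs;
the (0-based) epoch `k` uses the permutation `πs k` and the step size `η k`. -/
noncomputable def xSeq (A : Matrix (Fin (b * m)) (Fin d) ℝ) (g : Fin (b * m) → ℝ → ℝ)
    (η : ℕ → ℝ) (πs : ℕ → Equiv.Perm (Fin (b * m))) (x0 : Fin d → ℝ) : ℕ → Fin d → ℝ
  | 0 => x0
  | k + 1 => inIter A g (η k) (πs k) (xSeq A g η πs x0 k) m

/-- the convex (Fenchel) conjugate of `f : ℝ → ℝ` -/
noncomputable def fconj (f : ℝ → ℝ) (y : ℝ) : ℝ := sSup (Set.range fun t => y * t - f t)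

/-- the Lagrangian `𝓛(x,y) = (1/n) ⟨A x, y⟩ - (1/n) ∑ᵢ ℓᵢ*(yⁱ)` -/
noncomputable def Lagr (A : Matrix (Fin (b * m)) (Fin d) ℝ) (ℓ : Fin (b * m) → ℝ → ℝ)
    (x : Fin d → ℝ) (y : Fin (b * m) → ℝ) : ℝ :=
  (1 / ((b * m : ℕ) : ℝ)) * ∑ i, dot (A i) x * y i
    - (1 / ((b * m : ℕ) : ℝ)) * ∑ i, fconj (ℓ i) (y i)

/-- `g` is a (global) subgradient of `f` at `t` -/
def IsSubgrad (f : ℝ → ℝ) (t g : ℝ) : Prop := ∀ s, f t + g * (s - t) ≤ f s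

/-- expectation with respect to the uniform distribution on a finite type -/
noncomputable def Eunif {α : Type*} [Fintype α] (F : α → ℝ) : ℝ :=
  (∑ a : α, F a) / (Fintype.card α : ℝ)

/-- extend a `K`-tuple of permutations to an `ℕ`-indexed sequence (by the identity) -/
def extSeq {K n : ℕ} (g : Fin K → Equiv.Perm (Fin n)) : ℕ → Equiv.Perm (Fin n) :=
  fun k => if h : k < K then g ⟨k, h⟩ else 1

theorem convexOn_tangent_le {f : ℝ → ℝ} (hf : ConvexOn ℝ Set.univ f) {t c : ℝ}
    (hc : HasDerivAt f c t) (s : ℝ) : f t + c * (s - t) ≤ f s := by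
  rcases lt_trichotomy s t with h | h | h
  · have := hf.slope_le_of_hasDerivAt (Set.mem_univ s) (Set.mem_univ t) h hc
    rw [slope_def_field, div_le_iff₀ (by linarith)] at this
    linarith
  · simp [h]
  · have := hf.le_slope_of_hasDerivAt (Set.mem_univ t) (Set.mem_univ s) h hc
    rw [slope_def_field, le_div_iff₀ (by linarith)] at this
    linarith

theorem smooth_le_quadratic {f f' : ℝ → ℝ} {L : ℝ} (hf : ∀ t, HasDerivAt f (f' t) t)
    (hL : ∀ s t, |f' s - f' t| ≤ L * |s - t|) (s t : ℝ) :
    f s ≤ f t + f' t * (s - t) + L / 2 * (s - t) ^ 2 := by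
  have hd : ∀ u, HasDerivAt (fun v => L / 2 * v ^ 2 - f v) (L * u - f' u) u := by
    intro u
    have h := ((hasDerivAt_pow 2 u).const_mul (L / 2)).sub (hf u)
    exact h.congr_deriv (by simp; ring)
  have hc : ConvexOn ℝ Set.univ (fun v => L / 2 * v ^ 2 - f v) := by
    refine Monotone.convexOn_univ_of_deriv (fun u => (hd u).differentiableAt) ?_
    intro u v huv
    rw [(hd u).deriv, (hd v).deriv]
    have := (le_abs_self _).trans (hL v u)
    rw [abs_of_nonneg (sub_nonneg.2 huv)] at this
    linarith
  have := convexOn_tangent_le hc (hd t) s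
  nlinarith

theorem convexOn_smooth_gap {f f' : ℝ → ℝ} {L : ℝ} (hpos : 0 < L)
    (hconv : ConvexOn ℝ Set.univ f) (hf : ∀ t, HasDerivAt f (f' t) t)
    (hL : ∀ s t, |f' s - f' t| ≤ L * |s - t|) (s t : ℝ) :
    f t + f' t * (s - t) + (f' s - f' t) ^ 2 / (2 * L) ≤ f s := by
  have h1 := smooth_le_quadratic hf hL (s - (f' s - f' t) / L) s
  have h2 := convexOn_tangent_le hconv (hf t) (s - (f' s - f' t) / L)
  have e : f' s * (s - (f' s - f' t) / L - s) + L / 2 * (s - (f' s - f' t) / L - s) ^ 2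
      - f' t * (s - (f' s - f' t) / L - t) = - (f' t * (s - t)) - (f' s - f' t) ^ 2 / (2 * L) := by
    field_simp
    ring
  linarith

/-- One-sample estimate: the loss gap at `s`, measured with the derivative taken at `r`. -/
theorem loss_gap_le {f f' : ℝ → ℝ} {L : ℝ} (hpos : 0 < L)
    (hconv : ConvexOn ℝ Set.univ f) (hf : ∀ t, HasDerivAt f (f' t) t)
    (hL : ∀ s t, |f' s - f' t| ≤ L * |s - t|) (s r t : ℝ) :
    f s - f t ≤ f' r * (s - t) + L * (s - r) ^ 2 / 2 - (f' r - f' t) ^ 2 / L / 2 := by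
  have h1 := convexOn_smooth_gap hpos hconv hf hL r s
  have h2 := convexOn_smooth_gap hpos hconv hf hL t r
  have h3 : (f' s - f' r) * (s - r) ≤ L * (s - r) ^ 2 / 2 + (f' r - f' s) ^ 2 / (2 * L) := by
    have : 0 ≤ (L * (s - r) - (f' s - f' r)) ^ 2 / (2 * L) := by positivity
    have e : (L * (s - r) - (f' s - f' r)) ^ 2 / (2 * L) = L * (s - r) ^ 2 / 2 +
        (f' r - f' s) ^ 2 / (2 * L) - (f' s - f' r) * (s - r) := by
      field_simp
      ring
    linarith
  have e2 : (f' t - f' r) ^ 2 / (2 * L) = (f' r - f' t) ^ 2 / L / 2 := by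
    field_simp
    ring
  linarith

theorem sq_nonneg' {ι : Type*} [Fintype ι] (x : ι → ℝ) : 0 ≤ sq x :=
  Finset.sum_nonneg fun _ _ => sq_nonneg _

theorem dot_sq_le {ι : Type*} [Fintype ι] (x y : ι → ℝ) : dot x y ^ 2 ≤ sq x * sq y :=
  Finset.sum_mul_sq_le_sq_mul_sq _ _ _

theorem opNorm_nonneg {α β : Type*} [Fintype α] [Fintype β] [DecidableEq β]
    (M : Matrix α β ℝ) : 0 ≤ opNorm M := norm_nonneg _

theorem dot_mulVec_le {α : Type*} [Fintype α] [DecidableEq α] (M : Matrix α α ℝ) (u : α → ℝ) :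
    dot u (M *ᵥ u) ≤ opNorm M * sq u := by
  have h1 := (LinearMap.toContinuousLinearMap (Matrix.toEuclideanLin M)).le_opNorm
    (WithLp.toLp 2 u)
  have h2 := real_inner_le_norm (WithLp.toLp 2 u)
    (LinearMap.toContinuousLinearMap (Matrix.toEuclideanLin M) (WithLp.toLp 2 u))
  have e1 : sq u = ‖WithLp.toLp 2 u‖ ^ 2 := by
    simp [sq, EuclideanSpace.norm_sq_eq]
  have e2 : inner ℝ (WithLp.toLp 2 u)
      (LinearMap.toContinuousLinearMap (Matrix.toEuclideanLin M) (WithLp.toLp 2 u))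
      = dot u (M *ᵥ u) := by
    simp [dot, PiLp.inner_apply, mul_comm, Matrix.toLpLin_apply]
  rw [e1, ← e2, opNorm]
  nlinarith [norm_nonneg (WithLp.toLp 2 u)]

theorem dot_diagonal_gram {N e k : ℕ} (B : Matrix (Fin N) (Fin e) ℝ) (r : Fin N → ℝ)
    (χ : Fin k → Fin N → ℝ) (u : Fin N → ℝ) :
    dot u ((Matrix.diagonal r * (∑ j, Matrix.diagonal (χ j) * (B * Bᵀ) * Matrix.diagonal (χ j)) *
      Matrix.diagonal r) *ᵥ u) = ∑ j, sq (fun t => ∑ p, χ j p * (r p * u p) * B p t) := by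
  have : ∀ x y : Fin N → ℝ, dot x y = x ⬝ᵥ y := fun _ _ => rfl
  have e : ∀ j, Matrix.diagonal r * (Matrix.diagonal (χ j) * (B * Bᵀ) * Matrix.diagonal (χ j)) *
      Matrix.diagonal r = (Matrix.diagonal r * Matrix.diagonal (χ j) * B) *
        (Matrix.diagonal r * Matrix.diagonal (χ j) * B)ᵀ := by
    intro j
    simp only [Matrix.transpose_mul, Matrix.diagonal_transpose, Matrix.mul_assoc]
  rw [this, Matrix.mul_sum, Matrix.sum_mul, Matrix.sum_mulVec, dotProduct_sum]
  refine Finset.sum_congr rfl fun j _ => ?_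
  rw [e, ← Matrix.mulVec_mulVec, Matrix.dotProduct_mulVec, ← Matrix.mulVec_transpose]
  rw [sq]
  refine Finset.sum_congr rfl fun t _ => ?_
  rw [← pow_two]
  congr 1
  simp only [Matrix.mulVec, dotProduct, Matrix.transpose_apply, Matrix.diagonal_mul_diagonal,
    Matrix.diagonal_mul]
  exact Finset.sum_congr rfl fun p _ => by ring

/-- Upper bound on a family of masked Gram forms by the weighted norm of the coefficients. -/
theorem sum_sq_masked_le {N e k : ℕ} (B : Matrix (Fin N) (Fin e) ℝ) (w : Fin N → ℝ)
    (hw : ∀ p, 0 < w p) (χ : Fin k → Fin N → ℝ) (z : Fin N → ℝ) :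
    ∑ j, sq (fun t => ∑ p, χ j p * z p * B p t) ≤
      opNorm (Matrix.diagonal (fun p => √(w p)) *
        (∑ j, Matrix.diagonal (χ j) * (B * Bᵀ) * Matrix.diagonal (χ j)) *
        Matrix.diagonal (fun p => √(w p))) * ∑ p, z p ^ 2 / w p := by
  have h := dot_mulVec_le (Matrix.diagonal (fun p => √(w p)) *
        (∑ j, Matrix.diagonal (χ j) * (B * Bᵀ) * Matrix.diagonal (χ j)) *
        Matrix.diagonal (fun p => √(w p))) (fun p => z p / √(w p))
  rw [dot_diagonal_gram] at h
  have e1 : sq (fun p => z p / √(w p)) = ∑ p, z p ^ 2 / w p := by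
    refine Finset.sum_congr rfl fun p _ => ?_
    rw [div_pow, Real.sq_sqrt (hw p).le]
  have e2 : ∀ p, √(w p) * (z p / √(w p)) = z p := fun p => by
    have := Real.sqrt_pos.2 (hw p)
    field_simp
  simpa only [e1, e2] using h

/-- The dual estimate: one masked block of weighted inner products is bounded by the norm. -/
theorem sum_masked_dot_sq_le {N e k : ℕ} (B : Matrix (Fin N) (Fin e) ℝ) (w : Fin N → ℝ)
    (hw : ∀ p, 0 < w p) (χ : Fin k → Fin N → ℝ) (hχ : ∀ j p, χ j p = 0 ∨ χ j p = 1)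
    (j : Fin k) (v : Fin e → ℝ) :
    ∑ p, χ j p * (w p * dot (B p) v ^ 2) ≤
      opNorm (Matrix.diagonal (fun p => √(w p)) *
        (∑ j, Matrix.diagonal (χ j) * (B * Bᵀ) * Matrix.diagonal (χ j)) *
        Matrix.diagonal (fun p => √(w p))) * sq v := by
  set T := opNorm (Matrix.diagonal (fun p => √(w p)) *
        (∑ j, Matrix.diagonal (χ j) * (B * Bᵀ) * Matrix.diagonal (χ j)) *
        Matrix.diagonal (fun p => √(w p))) with hT
  set z : Fin N → ℝ := fun p => χ j p * (w p * dot (B p) v) with hz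
  set S := ∑ p, χ j p * (w p * dot (B p) v ^ 2) with hS
  have hidem : ∀ p, χ j p * χ j p = χ j p := fun p => by rcases hχ j p with h | h <;> simp [h]
  have h1 : sq (fun t => ∑ p, χ j p * z p * B p t) ≤ T * S := by
    have h := sum_sq_masked_le B w hw χ z
    have e : ∑ p, z p ^ 2 / w p = S := by
      refine Finset.sum_congr rfl fun p _ => ?_
      have := (hw p).ne'
      have h2 : z p ^ 2 / w p = (χ j p * χ j p) * (w p * dot (B p) v ^ 2) := by
        rw [hz]; field_simp
      rw [h2, hidem]
    rw [e] at h
    exact (Finset.single_le_sum (f := fun j => sq (fun t => ∑ p, χ j p * z p * B p t))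
      (fun i _ => sq_nonneg' _) (Finset.mem_univ j)).trans h
  have h2 : S = dot (fun t => ∑ p, χ j p * z p * B p t) v := by
    simp only [dot, Finset.sum_mul]
    rw [Finset.sum_comm]
    refine Finset.sum_congr rfl fun p _ => ?_
    have : ∑ t, χ j p * z p * B p t * v t = χ j p * z p * dot (B p) v := by
      rw [dot, Finset.mul_sum]
      exact Finset.sum_congr rfl fun t _ => by ring
    have h3 : χ j p * z p = z p := by
      rw [hz]
      simp only [← mul_assoc, hidem]
    rw [this, h3, hz]
    ring
  have h3 : S ^ 2 ≤ T * S * sq v := by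
    calc S ^ 2 ≤ _ := by rw [h2]; exact dot_sq_le _ _
      _ ≤ _ := mul_le_mul_of_nonneg_right h1 (sq_nonneg' v)
  have hT0 : 0 ≤ T := opNorm_nonneg _
  have hv := sq_nonneg' v
  by_contra! hlt
  have hS0 : 0 < S := lt_of_le_of_lt (by positivity) hlt
  nlinarith

theorem sum_perm_mul_swap {N : ℕ} (z : Fin N → ℝ) (σ : Equiv.Perm (Fin N)) (p q : Fin N) :
    ∑ π : Equiv.Perm (Fin N), z (π (σ p)) * z (π (σ q)) =
      ∑ π : Equiv.Perm (Fin N), z (π p) * z (π q) :=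
  Fintype.sum_equiv (Equiv.mulRight σ) _ _ fun _ => rfl

theorem Eunif_perm_sq {N : ℕ} (z : Fin N → ℝ) (p : Fin N) :
    Eunif (fun π : Equiv.Perm (Fin N) => z (π p) * z (π p)) = (∑ q, z q ^ 2) / N := by
  have hN : (N : ℝ) ≠ 0 := Nat.cast_ne_zero.2 (Fin.pos p).ne'
  have hF : (Fintype.card (Equiv.Perm (Fin N)) : ℝ) ≠ 0 := Nat.cast_ne_zero.2 Fintype.card_ne_zero
  have h1 : ∑ q, ∑ π : Equiv.Perm (Fin N), z (π q) * z (π q)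
      = N * ∑ π : Equiv.Perm (Fin N), z (π p) * z (π p) := by
    rw [Finset.sum_congr rfl (g := fun _ => ∑ π : Equiv.Perm (Fin N), z (π p) * z (π p))]
    · simp
    · intro q _
      have := sum_perm_mul_swap z (Equiv.swap p q) p p
      simpa using this
  have h2 : ∑ q, ∑ π : Equiv.Perm (Fin N), z (π q) * z (π q)
      = Fintype.card (Equiv.Perm (Fin N)) * ∑ q, z q ^ 2 := by
    rw [Finset.sum_comm, Finset.sum_congr rfl (g := fun _ => ∑ q, z q ^ 2)]
    · simp
    · intro π _
      simp only [← pow_two]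
      exact Equiv.sum_comp π (fun q => z q ^ 2)
  rw [Eunif, div_eq_div_iff hF hN]
  linarith

theorem Eunif_perm_mul {N : ℕ} (z : Fin N → ℝ) (hz : ∑ q, z q = 0) {p q : Fin N} (hpq : p ≠ q) :
    Eunif (fun π : Equiv.Perm (Fin N) => z (π p) * z (π q)) =
      - ((∑ q, z q ^ 2) / N) / (N - 1) := by
  have hN : 2 ≤ N := by
    have := p.2; have := q.2
    have : p.1 ≠ q.1 := fun h => hpq (Fin.ext h)
    omega
  have hN1 : (N : ℝ) - 1 ≠ 0 := by
    have : (2 : ℝ) ≤ N := by exact_mod_cast hN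
    linarith
  have h1 : ∑ r ∈ univ.erase p, ∑ π : Equiv.Perm (Fin N), z (π p) * z (π r)
      = (N - 1) * ∑ π : Equiv.Perm (Fin N), z (π p) * z (π q) := by
    rw [Finset.sum_congr rfl (g := fun _ => ∑ π : Equiv.Perm (Fin N), z (π p) * z (π q))]
    · simp [Nat.cast_sub (show 1 ≤ N by omega)]
    · intro r hr
      have := sum_perm_mul_swap z (Equiv.swap q r) p q
      rwa [Equiv.swap_apply_of_ne_of_ne hpq (Finset.ne_of_mem_erase hr).symm,
        Equiv.swap_apply_left] at this
  have h2 : ∑ r, ∑ π : Equiv.Perm (Fin N), z (π p) * z (π r) = 0 := by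
    rw [Finset.sum_comm]
    refine Finset.sum_eq_zero fun π _ => ?_
    rw [← Finset.mul_sum, Equiv.sum_comp π z, hz, mul_zero]
  rw [← Finset.add_sum_erase _ _ (Finset.mem_univ p), h1] at h2
  rw [← Eunif_perm_sq z p, eq_div_iff hN1, Eunif, Eunif, div_mul_eq_mul_div, ← neg_div]
  congr 1
  linarith

theorem Eunif_sum {α κ : Type*} [Fintype α] (s : Finset κ) (F : κ → α → ℝ) :
    Eunif (fun a => ∑ i ∈ s, F i a) = ∑ i ∈ s, Eunif (F i) := by
  simp only [Eunif, Finset.sum_div]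
  rw [Finset.sum_comm]

theorem Eunif_const_mul {α : Type*} [Fintype α] (c : ℝ) (F : α → ℝ) :
    Eunif (fun a => c * F a) = c * Eunif F := by
  simp only [Eunif, ← Finset.mul_sum, mul_div_assoc]

theorem Eunif_const {α : Type*} [Fintype α] [Nonempty α] (c : ℝ) :
    Eunif (fun _ : α => c) = c := by
  have : (Fintype.card α : ℝ) ≠ 0 := Nat.cast_ne_zero.2 Fintype.card_ne_zero
  simp [Eunif, this]

theorem Eunif_add {α : Type*} [Fintype α] (F G : α → ℝ) :
    Eunif (fun a => F a + G a) = Eunif F + Eunif G := by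
  simp only [Eunif, Finset.sum_add_distrib, add_div]

theorem Eunif_mono {α : Type*} [Fintype α] {F G : α → ℝ} (h : ∀ a, F a ≤ G a) :
    Eunif F ≤ Eunif G :=
  div_le_div_of_nonneg_right (Finset.sum_le_sum fun a _ => h a) (Nat.cast_nonneg _)

theorem Eunif_pi_eval {K : ℕ} {α : Type*} [Fintype α] [Nonempty α] (k : Fin K) (F : α → ℝ) :
    Eunif (fun g : Fin K → α => F (g k)) = Eunif F := by
  have hα : (Fintype.card α : ℝ) ≠ 0 := Nat.cast_ne_zero.2 Fintype.card_ne_zero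
  have h : ∑ g : Fin K → α, F (g k) = (Fintype.card α : ℝ) ^ (K - 1) * ∑ a, F a := by
    rw [← Equiv.sum_comp (Equiv.funSplitAt k α).symm, Fintype.sum_prod_type]
    simp [Finset.mul_sum]
  rw [Eunif, Eunif, h, Fintype.card_fun, Fintype.card_fin, Nat.cast_pow]
  obtain ⟨j, rfl⟩ : ∃ j, K = j + 1 := ⟨K - 1, by have := k.2; omega⟩
  rw [Nat.add_sub_cancel]
  field_simp
  ring

/-- Second moment of a partial sum under sampling without replacement. -/
theorem Eunif_perm_sum_sq {N : ℕ} (z : Fin N → ℝ) (hz : ∑ q, z q = 0) (S : Finset (Fin N)) :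
    Eunif (fun π : Equiv.Perm (Fin N) => (∑ p ∈ S, z (π p)) ^ 2) =
      (#S : ℝ) * (N - #S) / (N - 1) * ((∑ q, z q ^ 2) / N) := by
  set V := (∑ q, z q ^ 2) / (N : ℝ) with hV
  have h : ∀ p ∈ S, ∑ q ∈ S, Eunif (fun π : Equiv.Perm (Fin N) => z (π p) * z (π q))
      = V - (#S - 1) * V / (N - 1) := by
    intro p hp
    rw [← Finset.add_sum_erase _ _ hp, Eunif_perm_sq, ← hV,
      Finset.sum_congr rfl (g := fun _ => -V / (N - 1))]
    · rw [Finset.sum_const, Finset.card_erase_of_mem hp, nsmul_eq_mul,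
        Nat.cast_sub (Finset.card_pos.2 ⟨p, hp⟩)]
      push_cast
      ring
    · intro q hq
      exact Eunif_perm_mul z hz (Finset.ne_of_mem_erase hq).symm
  have e : (fun π : Equiv.Perm (Fin N) => (∑ p ∈ S, z (π p)) ^ 2) =
      fun π => ∑ p ∈ S, ∑ q ∈ S, z (π p) * z (π q) := by
    funext π
    rw [pow_two, Finset.sum_mul_sum]
  rw [e, Eunif_sum]
  simp only [Eunif_sum]
  rw [Finset.sum_congr rfl h, Finset.sum_const, nsmul_eq_mul]
  rcases eq_or_ne ((N : ℝ) - 1) 0 with h0 | h0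
  · have hN : N = 1 := by
      have : (N : ℝ) = 1 := by linarith
      exact_mod_cast this
    subst hN
    have : V = 0 := by
      rw [hV]
      simp at hz ⊢
      exact hz
    simp [this]
  · field_simp
    ring

theorem sum_idx (i : Fin m) (F : Fin (b * m) → ℝ) :
    ∑ j : Fin b, F (idx b m i j) =
      ∑ p, if b * i.1 ≤ p.1 ∧ p.1 < b * (i.1 + 1) then F p else 0 := by
  rw [← Finset.sum_filter]
  refine Finset.sum_of_injOn (idx b m i) ?_ ?_ ?_ (fun _ _ => rfl)
  · intro j _ k _ h
    have := congrArg Fin.val h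
    simp only [idx] at this
    exact Fin.ext (by omega)
  · intro j _
    have := j.2
    simp only [Finset.coe_filter, Finset.mem_univ, true_and, Set.mem_ofPred_eq, idx, mul_add]
    omega
  · intro p hp hn
    simp only [Finset.mem_filter, Finset.mem_univ, true_and, mul_add] at hp
    exact absurd ⟨⟨p.1 - b * i.1, by omega⟩, by simp, Fin.ext (by simp only [idx]; omega)⟩ hn

theorem div_eq_of_mem_block {p i : ℕ} (h1 : b * i ≤ p) (h2 : p < b * (i + 1)) : p / b = i :=
  Nat.div_eq_of_lt_le (by rwa [mul_comm]) (by rwa [mul_comm])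

theorem inIter_eq (A : Matrix (Fin (b * m)) (Fin d) ℝ) (g : Fin (b * m) → ℝ → ℝ)
    (η : ℝ) (π : Equiv.Perm (Fin (b * m))) (x0 : Fin d → ℝ) (i : ℕ) (hi : i ≤ m) (t : Fin d) :
    inIter A g η π x0 i t = x0 t - η / b *
      ∑ p, if p.1 < b * i then dualY A g η π x0 p * A (π p) t else 0 := by
  induction i with
  | zero => simp [inIter]
  | succ i ih =>
    have hlt : i < m := hi
    have e : ∑ j : Fin b, g (π (idx b m ⟨i, hlt⟩ j))
          (dot (A (π (idx b m ⟨i, hlt⟩ j))) (inIter A g η π x0 i)) * A (π (idx b m ⟨i, hlt⟩ j)) t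
        = ∑ p : Fin (b * m), if b * i ≤ p.1 ∧ p.1 < b * (i + 1) then
            dualY A g η π x0 p * A (π p) t else 0 := by
      rw [sum_idx ⟨i, hlt⟩ (fun p => g (π p) (dot (A (π p)) (inIter A g η π x0 i)) * A (π p) t)]
      refine Finset.sum_congr rfl fun p _ => ?_
      split_ifs with h
      · rw [dualY, div_eq_of_mem_block h.1 h.2]
      · rfl
    rw [inIter, dif_pos hlt, step, e, ih hlt.le, sub_sub, ← mul_add, ← Finset.sum_add_distrib]
    congr 2
    refine Finset.sum_congr rfl fun p _ => ?_
    have : b * i ≤ b * (i + 1) := Nat.mul_le_mul_left b (Nat.le_succ i)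
    split_ifs <;> first | omega | simp

theorem sum_block_indicator (p : Fin (b * m)) (G : ℕ → ℝ) :
    ∑ i : Fin m, (if b * i.1 ≤ p.1 ∧ p.1 < b * (i.1 + 1) then (1 : ℝ) else 0) * G i.1
      = G (p.1 / b) := by
  have hlt : p.1 / b < m := Nat.div_lt_of_lt_mul p.2
  have hb : 0 < b := Nat.pos_of_ne_zero fun h => by have := p.2; simp [h] at this
  rw [Finset.sum_eq_single ⟨p.1 / b, hlt⟩]
  · rw [if_pos ⟨Nat.mul_div_le _ _, Nat.lt_mul_div_succ _ hb⟩, one_mul]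
  · intro i _ hi
    rw [if_neg, zero_mul]
    rintro ⟨h1, h2⟩
    exact hi (Fin.ext (div_eq_of_mem_block h1 h2).symm)
  · simp

theorem hatC_nonneg (A : Matrix (Fin (b * m)) (Fin d) ℝ) (w : Fin (b * m) → ℝ)
    (π : Equiv.Perm (Fin (b * m))) : 0 ≤ hatC A w π :=
  mul_nonneg (by positivity) (opNorm_nonneg _)

theorem tilC_nonneg (A : Matrix (Fin (b * m)) (Fin d) ℝ) (w : Fin (b * m) → ℝ)
    (π : Equiv.Perm (Fin (b * m))) : 0 ≤ tilC A w π :=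
  mul_nonneg (by positivity) (opNorm_nonneg _)

theorem sum_tail_sq_le_hatC (hb : 0 < b) (hm : 0 < m) (A : Matrix (Fin (b * m)) (Fin d) ℝ)
    {w : Fin (b * m) → ℝ} (hw : ∀ i, 0 < w i) (π : Equiv.Perm (Fin (b * m)))
    (z : Fin (b * m) → ℝ) :
    ∑ i : Fin m, sq (fun t => ∑ p, (if b * i.1 ≤ p.1 then (1 : ℝ) else 0) * z p * A (π p) t) ≤
      m * (b * m) * hatC A w π * ∑ p, z p ^ 2 / w (π p) := by
  have h := sum_sq_masked_le (permMat A π) (fun p => w (π p)) (fun p => hw _)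
    (fun (i : Fin m) p => if b * i.1 ≤ p.1 then (1 : ℝ) else 0) z
  refine h.trans (le_of_eq ?_)
  congr 1
  have : (b : ℝ) ≠ 0 := by positivity
  have : (m : ℝ) ≠ 0 := by positivity
  rw [hatC]
  simp only [Iup]
  push_cast
  field_simp

theorem sum_block_sq_le_tilC (hb : 0 < b) (A : Matrix (Fin (b * m)) (Fin d) ℝ)
    {w : Fin (b * m) → ℝ} (hw : ∀ i, 0 < w i) (π : Equiv.Perm (Fin (b * m)))
    (v : ℕ → Fin d → ℝ) :
    ∑ p, w (π p) * dot (A (π p)) (v (p.1 / b)) ^ 2 ≤ b * tilC A w π * ∑ i : Fin m, sq (v i) := by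
  have hT : b * tilC A w π = opNorm
    (Matrix.diagonal (fun i => Real.sqrt (w (π i))) *
      (∑ j : Fin m,
        Iblk (b * m) b j.1 * (permMat A π * (permMat A π)ᵀ) * Iblk (b * m) b j.1) *
      Matrix.diagonal (fun i => Real.sqrt (w (π i)))) := by
    have : (b : ℝ) ≠ 0 := by positivity
    rw [tilC]
    field_simp
  have h : ∀ i : Fin m, ∑ p : Fin (b * m),
      (if b * i.1 ≤ p.1 ∧ p.1 < b * (i.1 + 1) then (1 : ℝ) else 0) *
      (w (π p) * dot (A (π p)) (v i) ^ 2) ≤ b * tilC A w π * sq (v i) := by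
    intro i
    rw [hT]
    exact sum_masked_dot_sq_le (permMat A π) (fun p => w (π p)) (fun p => hw _)
      (fun (i : Fin m) p => if b * i.1 ≤ p.1 ∧ p.1 < b * (i.1 + 1) then (1 : ℝ) else 0)
      (fun j p => by split_ifs <;> simp) i (v i)
  calc _ = ∑ p : Fin (b * m), ∑ i : Fin m,
      (if b * i.1 ≤ p.1 ∧ p.1 < b * (i.1 + 1) then (1 : ℝ) else 0) *
      (w (π p) * dot (A (π p)) (v i) ^ 2) := Finset.sum_congr rfl fun p _ =>
        (sum_block_indicator p (fun i => w (π p) * dot (A (π p)) (v i) ^ 2)).symm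
    _ = _ := Finset.sum_comm
    _ ≤ _ := by
      rw [Finset.mul_sum]
      exact Finset.sum_le_sum fun i _ => h i

theorem sq_add_le {ι : Type*} [Fintype ι] (x y : ι → ℝ) :
    sq (fun t => x t + y t) ≤ 2 * sq x + 2 * sq y := by
  simp only [sq, Finset.mul_sum, ← Finset.sum_add_distrib]
  exact Finset.sum_le_sum fun t _ => by nlinarith [sq_nonneg (x t - y t)]

theorem dot_sub {ι : Type*} [Fintype ι] (x y z : ι → ℝ) :
    dot x (fun t => y t - z t) = dot x y - dot x z := by
  simp only [dot, mul_sub, Finset.sum_sub_distrib]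

theorem inIter_last_sub (A : Matrix (Fin (b * m)) (Fin d) ℝ) (g : Fin (b * m) → ℝ → ℝ)
    (η : ℝ) (π : Equiv.Perm (Fin (b * m))) (x0 : Fin d → ℝ) (i : ℕ) (hi : i ≤ m) (t : Fin d) :
    inIter A g η π x0 m t - inIter A g η π x0 i t = - (η / b) *
      ∑ p : Fin (b * m), (if b * i ≤ p.1 then (1 : ℝ) else 0) *
        dualY A g η π x0 p * A (π p) t := by
  rw [inIter_eq A g η π x0 m le_rfl, inIter_eq A g η π x0 i hi, sub_sub_sub_cancel_left,
    ← mul_sub, ← Finset.sum_sub_distrib, neg_mul, ← mul_neg, ← Finset.sum_neg_distrib]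
  congr 1
  refine Finset.sum_congr rfl fun p _ => ?_
  have := p.2
  split_ifs <;> first | omega | simp

/-- The per-epoch inequality, for a fixed permutation. -/
theorem epoch_gap_le (hb : 0 < b) (hm : 0 < m)
    (A : Matrix (Fin (b * m)) (Fin d) ℝ)
    (ℓ ℓ' : Fin (b * m) → ℝ → ℝ) (L : Fin (b * m) → ℝ)
    (hL : ∀ i, 0 < L i)
    (hconv : ∀ i, ConvexOn ℝ Set.univ (ℓ i))
    (hderiv : ∀ i t, HasDerivAt (ℓ i) (ℓ' i t) t)
    (hsmooth : ∀ i s t, |ℓ' i s - ℓ' i t| ≤ L i * |s - t|)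
    (xs : Fin d → ℝ) (η : ℝ) (hη : 0 < η) (π : Equiv.Perm (Fin (b * m)))
    (hstep : η ≤ (b : ℝ) / (((b * m : ℕ) : ℝ) * Real.sqrt (2 * hatC A L π * tilC A L π)))
    (x0 : Fin d → ℝ) :
    (η / b) * (∑ i, ℓ i (dot (A i) (inIter A ℓ' η π x0 m)) - ∑ i, ℓ i (dot (A i) xs)) ≤
      (sq (fun t => x0 t - xs t) - sq (fun t => inIter A ℓ' η π x0 m t - xs t)) / 2 +
      η ^ 3 * tilC A L π / b ^ 2 * ∑ i : Fin m, sq (fun t => ∑ p : Fin (b * m),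
        (if b * i.1 ≤ p.1 then (1 : ℝ) else 0) * ℓ' (π p) (dot (A (π p)) xs) * A (π p) t) := by
  set xm := inIter A ℓ' η π x0 m with hxm
  set y := dualY A ℓ' η π x0 with hy
  set ys : Fin (b * m) → ℝ := fun p => ℓ' (π p) (dot (A (π p)) xs) with hys
  have hbR : (0 : ℝ) < b := by exact_mod_cast hb
  have hmR : (0 : ℝ) < m := by exact_mod_cast hm
  let tail : (Fin (b * m) → ℝ) → ℕ → Fin d → ℝ := fun z i t =>
    ∑ p : Fin (b * m), (if b * i ≤ p.1 then (1 : ℝ) else 0) * z p * A (π p) t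
  set T := tilC A L π with hT
  set H := hatC A L π with hH
  have hT0 : 0 ≤ T := tilC_nonneg _ _ _
  have hH0 : 0 ≤ H := hatC_nonneg _ _ _
  set D := ∑ p, (y p - ys p) ^ 2 / L (π p) with hD
  have hD0 : 0 ≤ D := Finset.sum_nonneg fun p _ => div_nonneg (sq_nonneg _) (hL _).le
  have hstep2 : η ^ 2 * m ^ 2 * (2 * H * T) ≤ 1 := by
    have hr0 := Real.sqrt_nonneg (2 * H * T)
    rcases hr0.eq_or_lt with h0 | h0
    · rw [← h0] at hstep
      simp at hstep
      linarith
    · have hn : (0 : ℝ) < ((b * m : ℕ) : ℝ) := by exact_mod_cast Nat.mul_pos hb hm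
      rw [le_div_iff₀ (by positivity)] at hstep
      push_cast at hstep
      have h1 : η * m * √(2 * H * T) ≤ 1 := by
        have : b * (η * m * √(2 * H * T)) ≤ b * 1 := by linarith
        exact le_of_mul_le_mul_left this hbR
      have h2 : (η * m * √(2 * H * T)) ^ 2 ≤ 1 := pow_le_one₀ (by positivity) h1
      rw [mul_pow, Real.sq_sqrt (by positivity), mul_pow] at h2
      exact h2
  have hsplit : ∑ i : Fin m, sq (tail y i) ≤
      2 * (m * (b * m) * H * D) + 2 * ∑ i : Fin m, sq (tail ys i) := by
    have h1 : ∑ i : Fin m, sq (tail (fun p => y p - ys p) i) ≤ m * (b * m) * H * D :=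
      sum_tail_sq_le_hatC hb hm A hL π (fun p => y p - ys p)
    have h2 : ∑ i : Fin m, sq (tail y i) ≤
        ∑ i : Fin m, (2 * sq (tail (fun p => y p - ys p) i) + 2 * sq (tail ys i)) := by
      refine Finset.sum_le_sum fun i _ => ?_
      have e : tail y i = fun t => tail (fun p => y p - ys p) i t + tail ys i t := by
        funext t
        simp only [tail, ← Finset.sum_add_distrib]
        exact Finset.sum_congr rfl fun p _ => by ring
      rw [e]
      exact sq_add_le _ _
    rw [Finset.sum_add_distrib, ← Finset.mul_sum, ← Finset.mul_sum] at h2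
    linarith
  have hblk : ∑ p, L (π p) * dot (A (π p)) (tail y (p.1 / b)) ^ 2 ≤
      b * T * ∑ i : Fin m, sq (tail y i) := sum_block_sq_le_tilC hb A hL π (tail y)
  have hone : ∀ p, ℓ (π p) (dot (A (π p)) xm) - ℓ (π p) (dot (A (π p)) xs) ≤
      y p * (dot (A (π p)) xm - dot (A (π p)) xs) +
      (η / b) ^ 2 / 2 * (L (π p) * dot (A (π p)) (tail y (p.1 / b)) ^ 2) -
      (y p - ys p) ^ 2 / L (π p) / 2 := by
    intro p
    have h := loss_gap_le (hL (π p)) (hconv (π p)) (hderiv (π p)) (hsmooth (π p))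
      (dot (A (π p)) xm) (dot (A (π p)) (inIter A ℓ' η π x0 (p.1 / b))) (dot (A (π p)) xs)
    have e : dot (A (π p)) xm - dot (A (π p)) (inIter A ℓ' η π x0 (p.1 / b)) =
        - (η / b) * dot (A (π p)) (tail y (p.1 / b)) := by
      rw [← dot_sub]
      have hlt : p.1 / b ≤ m := (Nat.div_lt_of_lt_mul p.2).le
      simp only [hxm, inIter_last_sub A ℓ' η π x0 _ hlt]
      simp only [dot, Finset.mul_sum (s := (univ : Finset (Fin d)))]
      exact Finset.sum_congr rfl fun t _ => by simp only [tail]; ring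
    rw [e] at h
    refine h.trans (le_of_eq ?_)
    simp only [hy, hys, dualY]
    ring
  have hsum := Finset.sum_le_sum (fun p (_ : p ∈ Finset.univ) => hone p)
  rw [Finset.sum_sub_distrib, Finset.sum_sub_distrib, Finset.sum_add_distrib, ← Finset.mul_sum,
    ← Finset.sum_div, Equiv.sum_comp π (fun i => ℓ i (dot (A i) xm)),
    Equiv.sum_comp π (fun i => ℓ i (dot (A i) xs))] at hsum
  have hlin : (η / b) * ∑ p, y p * (dot (A (π p)) xm - dot (A (π p)) xs) ≤
      (sq (fun t => x0 t - xs t) - sq (fun t => xm t - xs t)) / 2 := by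
    have e : (η / b) * ∑ p, y p * (dot (A (π p)) xm - dot (A (π p)) xs) =
        ∑ t, (x0 t - xm t) * (xm t - xs t) := by
      have h1 : ∀ t, x0 t - xm t = η / b * ∑ p, y p * A (π p) t := by
        intro t
        have h := inIter_last_sub A ℓ' η π x0 0 (Nat.zero_le _) t
        simp only [mul_zero, Nat.zero_le, if_true, one_mul, inIter] at h
        linarith
      simp only [h1, ← dot_sub]
      simp only [dot, Finset.mul_sum, Finset.sum_mul]
      rw [Finset.sum_comm]
      exact Finset.sum_congr rfl fun t _ => Finset.sum_congr rfl fun p _ => by ring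
    rw [e]
    simp only [sq]
    rw [← Finset.sum_sub_distrib, Finset.sum_div]
    exact Finset.sum_le_sum fun t _ => by nlinarith [sq_nonneg (x0 t - xm t)]
  set V := ∑ i : Fin m, sq (tail ys i) with hV
  have hquad : (η / b) ^ 2 / 2 * ∑ p, L (π p) * dot (A (π p)) (tail y (p.1 / b)) ^ 2 ≤
      D / 2 + (η ^ 2 * T / b) * V := by
    calc _ ≤ (η / b) ^ 2 / 2 * (b * T * (2 * (m * (b * m) * H * D) + 2 * V)) := by
            refine mul_le_mul_of_nonneg_left (hblk.trans ?_) (by positivity)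
            exact mul_le_mul_of_nonneg_left hsplit (by positivity)
      _ = (η ^ 2 * m ^ 2 * (2 * H * T)) * (D / 2) + (η ^ 2 * T / b) * V := by
            field_simp
      _ ≤ _ := by nlinarith
  have hfin : η / b * (D / 2 + (η ^ 2 * T / b) * V - D / 2) = η ^ 3 * T / b ^ 2 * V := by
    field_simp
    ring
  have hmul := mul_le_mul_of_nonneg_left hsum (show 0 ≤ η / (b : ℝ) by positivity)
  have hmul2 := mul_le_mul_of_nonneg_left hquad (show 0 ≤ η / (b : ℝ) by positivity)
  rw [← hD] at hmul
  change _ ≤ _ + η ^ 3 * T / b ^ 2 * V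
  rw [← hfin]
  linarith

theorem sum_range_mul_sub (c : ℝ) (m : ℕ) :
    ∑ i ∈ Finset.range m, (i : ℝ) * (c - i) =
      c * (m * (m - 1) / 2) - (m - 1) * m * (2 * m - 1) / 6 := by
  induction m with
  | zero => simp
  | succ k ih =>
    rw [Finset.sum_range_succ, ih]
    push_cast
    ring

theorem Eunif_tail_sq (A : Matrix (Fin (b * m)) (Fin d) ℝ) (c : Fin (b * m) → ℝ)
    (hc : ∀ t, ∑ q, c q * A q t = 0) (i : Fin m) :
    Eunif (fun π : Equiv.Perm (Fin (b * m)) => sq (fun t => ∑ p : Fin (b * m),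
        (if b * i.1 ≤ p.1 then (1 : ℝ) else 0) * c (π p) * A (π p) t)) =
      b ^ 2 * (i * (m - i)) / (((b * m : ℕ) : ℝ) - 1) *
        ((1 / ((b * m : ℕ) : ℝ)) * ∑ q, c q ^ 2 * sq (A q)) := by
  set S : Finset (Fin (b * m)) := univ.filter (fun p => b * i.1 ≤ p.1) with hS
  have hcard : (#S : ℝ) = b * (m - i) := by
    have h1 : #S = b * m - b * i.1 := by
      have h := Finset.card_filter_add_card_filter_not (s := (univ : Finset (Fin (b * m))))
        (fun p => b * i.1 ≤ p.1)
      have h2 : #(univ.filter (fun p : Fin (b * m) => ¬ b * i.1 ≤ p.1)) = b * i.1 := by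
        simp only [not_le]
        rw [Fin.card_filter_val_lt]
        exact min_eq_right (Nat.mul_le_mul_left b i.2.le)
      rw [h2, ← hS, Finset.card_univ, Fintype.card_fin] at h
      have hle : b * i.1 ≤ b * m := Nat.mul_le_mul_left b i.2.le
      omega
    rw [h1, Nat.cast_sub (Nat.mul_le_mul_left b i.2.le)]
    push_cast
    ring
  have e : (fun π : Equiv.Perm (Fin (b * m)) => sq (fun t => ∑ p : Fin (b * m),
        (if b * i.1 ≤ p.1 then (1 : ℝ) else 0) * c (π p) * A (π p) t)) =
      fun π => ∑ t, (∑ p ∈ S, (fun q => c q * A q t) (π p)) ^ 2 := by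
    funext π
    simp only [sq, hS, Finset.sum_filter]
    refine Finset.sum_congr rfl fun t _ => ?_
    congr 1
    refine Finset.sum_congr rfl fun p _ => ?_
    split_ifs <;> simp
  rw [e, Eunif_sum, Finset.sum_congr rfl fun t _ => Eunif_perm_sum_sq _ (hc t) S,
    ← Finset.mul_sum, ← Finset.sum_div, Finset.sum_comm, hcard]
  have h3 : ∀ q, ∑ t, (c q * A q t) ^ 2 = c q ^ 2 * sq (A q) := fun q => by
    simp only [sq, Finset.mul_sum, mul_pow]
  simp only [h3]
  push_cast
  ring

theorem Eunif_sum_tail_sq (hb : 0 < b) (A : Matrix (Fin (b * m)) (Fin d) ℝ)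
    (c : Fin (b * m) → ℝ) (hc : ∀ t, ∑ q, c q * A q t = 0) :
    Eunif (fun π : Equiv.Perm (Fin (b * m)) => ∑ i : Fin m, sq (fun t => ∑ p : Fin (b * m),
        (if b * i.1 ≤ p.1 then (1 : ℝ) else 0) * c (π p) * A (π p) t)) =
      ((b * m : ℕ) : ℝ) * (((b * m : ℕ) : ℝ) - b) * (((b * m : ℕ) : ℝ) + b) /
        (6 * b * (((b * m : ℕ) : ℝ) - 1)) *
        ((1 / ((b * m : ℕ) : ℝ)) * ∑ q, c q ^ 2 * sq (A q)) := by
  have hbR : (b : ℝ) ≠ 0 := by positivity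
  rw [Eunif_sum, Finset.sum_congr rfl fun i _ => Eunif_tail_sq A c hc i, ← Finset.sum_mul,
    ← Finset.sum_div, ← Finset.mul_sum, Fin.sum_univ_eq_sum_range (fun i => (i : ℝ) * (m - i)) m,
    sum_range_mul_sub]
  congr 1
  rw [mul_comm (6 * (b : ℝ)), ← div_div, div_right_comm]
  congr 1
  push_cast
  field_simp
  ring

theorem sum_deriv_mul_eq_zero (A : Matrix (Fin (b * m)) (Fin d) ℝ)
    (ℓ ℓ' : Fin (b * m) → ℝ → ℝ) (hderiv : ∀ i t, HasDerivAt (ℓ i) (ℓ' i t) t)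
    (xs : Fin d → ℝ)
    (hmin : ∀ x : Fin d → ℝ, ∑ i, ℓ i (dot (A i) xs) ≤ ∑ i, ℓ i (dot (A i) x)) (t : Fin d) :
    ∑ q, ℓ' q (dot (A q) xs) * A q t = 0 := by
  have hdot : ∀ q (s : ℝ), dot (A q) (xs + s • Pi.single t 1) = dot (A q) xs + s * A q t := by
    intro q s
    simp [dot, mul_add, Finset.sum_add_distrib, Pi.single_apply, mul_comm]
  have hd : HasDerivAt (fun s : ℝ => ∑ q, ℓ q (dot (A q) xs + s * A q t))
      (∑ q, ℓ' q (dot (A q) xs) * A q t) 0 := by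
    refine HasDerivAt.fun_sum fun q _ => ?_
    have h1 : HasDerivAt (fun s : ℝ => dot (A q) xs + s * A q t) (A q t) 0 := by
      simpa using ((hasDerivAt_id (0 : ℝ)).mul_const (A q t)).const_add (dot (A q) xs)
    have h2 : HasDerivAt (ℓ q) (ℓ' q (dot (A q) xs)) (dot (A q) xs + 0 * A q t) := by
      simpa using hderiv q (dot (A q) xs)
    exact h2.comp (0 : ℝ) h1
  refine IsLocalMin.hasDerivAt_eq_zero (Filter.Eventually.of_forall fun s => ?_) hd
  have := hmin (xs + s • Pi.single t 1)
  simpa [hdot] using this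

/-- Jensen's inequality for the averaged iterate. -/
theorem avg_gap_le {N e K : ℕ} (hK : 0 < K) (A : Matrix (Fin N) (Fin e) ℝ)
    (ℓ : Fin N → ℝ → ℝ) (hconv : ∀ i, ConvexOn ℝ Set.univ (ℓ i))
    (η : ℕ → ℝ) (hη : ∀ k, 0 < η k) (x : ℕ → Fin e → ℝ) (i : Fin N) :
    (∑ k ∈ Finset.range K, η k) * ℓ i (dot (A i)
        (fun t => (∑ k ∈ Finset.range K, η k * x k t) / ∑ k ∈ Finset.range K, η k)) ≤
      ∑ k ∈ Finset.range K, η k * ℓ i (dot (A i) (x k)) := by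
  set S := ∑ k ∈ Finset.range K, η k with hS
  have hS0 : 0 < S := Finset.sum_pos (fun k _ => hη k) (by simpa using hK.ne')
  have h := (hconv i).map_sum_le (t := Finset.range K) (w := fun k => η k / S)
    (p := fun k => dot (A i) (x k)) (fun k _ => (div_pos (hη k) hS0).le)
    (by rw [← Finset.sum_div, ← hS, div_self hS0.ne']) (fun _ _ => Set.mem_univ _)
  have e1 : dot (A i) (fun t => (∑ k ∈ Finset.range K, η k * x k t) / S) =
      ∑ k ∈ Finset.range K, (η k / S) • dot (A i) (x k) := by
    simp only [dot, smul_eq_mul, Finset.mul_sum, Finset.sum_div]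
    rw [Finset.sum_comm]
    exact Finset.sum_congr rfl fun k _ => Finset.sum_congr rfl fun t _ => by ring
  have e2 : ∑ k ∈ Finset.range K, η k * ℓ i (dot (A i) (x k)) =
      S * ∑ k ∈ Finset.range K, (η k / S) • ℓ i (dot (A i) (x k)) := by
    rw [Finset.mul_sum]
    exact Finset.sum_congr rfl fun k _ => by simp only [smul_eq_mul]; field_simp
  rw [e1, e2]
  exact mul_le_mul_of_nonneg_left h hS0.le

/-- **Theorem 3.1**: convergence bound for `K` epochs of shuffled SGD with uniformly
random shuffling, both for random reshuffling (first conjunct) and shuffle-once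
(second conjunct). -/
theorem stmt3
    (b m d K : ℕ) (hb : 0 < b) (hm : 0 < m) (hK : 0 < K)
    (A : Matrix (Fin (b * m)) (Fin d) ℝ)
    (ℓ ℓ' : Fin (b * m) → ℝ → ℝ) (L : Fin (b * m) → ℝ)
    (hL : ∀ i, 0 < L i)
    (hconv : ∀ i, ConvexOn ℝ Set.univ (ℓ i))
    (hderiv : ∀ i t, HasDerivAt (ℓ i) (ℓ' i t) t)
    (hsmooth : ∀ i s t, |ℓ' i s - ℓ' i t| ≤ L i * |s - t|)
    (xstar : Fin d → ℝ)
    (hmin : ∀ x : Fin d → ℝ,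
      (1 / ((b * m : ℕ) : ℝ)) * ∑ i, ℓ i (dot (A i) xstar)
        ≤ (1 / ((b * m : ℕ) : ℝ)) * ∑ i, ℓ i (dot (A i) x))
    (η : ℕ → ℝ) (hη : ∀ k, 0 < η k)
    (hstep : ∀ k < K, ∀ π : Equiv.Perm (Fin (b * m)),
      η k ≤ (b : ℝ) / (((b * m : ℕ) : ℝ) * Real.sqrt (2 * hatC A L π * tilC A L π)))
    (x0 : Fin d → ℝ) :
    let n : ℝ := ((b * m : ℕ) : ℝ)
    let f : (Fin d → ℝ) → ℝ := fun x => (1 / n) * ∑ i, ℓ i (dot (A i) x)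
    let σ2 : ℝ := (1 / n) * ∑ i, (ℓ' i (dot (A i) xstar)) ^ 2 * sq (A i)
    let Lt : ℝ := ⨆ π : Equiv.Perm (Fin (b * m)), tilC A L π
    let HK : ℝ := ∑ k ∈ Finset.range K, η k
    let val : (ℕ → Equiv.Perm (Fin (b * m))) → ℝ := fun πs =>
      HK * (f (fun t => (∑ k ∈ Finset.range K, η k * xSeq A ℓ' η πs x0 (k + 1) t) / HK)
              - f xstar)
    let bnd : ℝ := ((b : ℝ) / (2 * n)) * sq (fun t => x0 t - xstar t)
        + ∑ k ∈ Finset.range K,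
            ((η k) ^ 3 * Lt * (n - (b : ℝ)) * (n + (b : ℝ))
              / (6 * (b : ℝ) ^ 2 * (n - 1))) * σ2
    (Eunif (fun g : Fin K → Equiv.Perm (Fin (b * m)) => val (extSeq g)) ≤ bnd)
    ∧ (Eunif (fun π0 : Equiv.Perm (Fin (b * m)) => val (fun _ => π0)) ≤ bnd) := by
  intro n f σ2 Lt HK val bnd
  have hbR : (0 : ℝ) < b := by exact_mod_cast hb
  have hn : 0 < n := by
    have : 0 < b * m := Nat.mul_pos hb hm
    simp only [n]
    exact_mod_cast this
  have hmin' : ∀ x : Fin d → ℝ, ∑ i, ℓ i (dot (A i) xstar) ≤ ∑ i, ℓ i (dot (A i) x) :=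
    fun x => le_of_mul_le_mul_left (hmin x) (by positivity)
  have hzero := sum_deriv_mul_eq_zero A ℓ ℓ' hderiv xstar hmin'
  let Q : Equiv.Perm (Fin (b * m)) → ℝ := fun π => ∑ i : Fin m, sq (fun t => ∑ p : Fin (b * m),
    (if b * i.1 ≤ p.1 then (1 : ℝ) else 0) * ℓ' (π p) (dot (A (π p)) xstar) * A (π p) t)
  have hEQ : Eunif Q = n * (n - b) * (n + b) / (6 * b * (n - 1)) * σ2 :=
    Eunif_sum_tail_sq hb A (fun q => ℓ' q (dot (A q) xstar)) hzero
  have hQ0 : ∀ π, 0 ≤ Q π := fun π => Finset.sum_nonneg fun i _ => sq_nonneg' _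
  have hLt : ∀ π, tilC A L π ≤ Lt := fun π => le_ciSup (Set.finite_range _).bddAbove π
  have hHK : 0 < HK := Finset.sum_pos (fun k _ => hη k) (by simpa using hK.ne')
  have hepoch : ∀ πs : ℕ → Equiv.Perm (Fin (b * m)), ∀ k < K,
      η k * (f (xSeq A ℓ' η πs x0 (k + 1)) - f xstar) ≤
        b / (2 * n) * (sq (fun t => xSeq A ℓ' η πs x0 k t - xstar t) -
          sq (fun t => xSeq A ℓ' η πs x0 (k + 1) t - xstar t)) +
        η k ^ 3 * Lt / (b * n) * Q (πs k) := by
    intro πs k hk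
    have h := epoch_gap_le hb hm A ℓ ℓ' L hL hconv hderiv hsmooth xstar (η k) (hη k) (πs k)
      (hstep k hk (πs k)) (xSeq A ℓ' η πs x0 k)
    have h1 : η k ^ 3 * tilC A L (πs k) / b ^ 2 * Q (πs k) ≤
        η k ^ 3 * Lt / b ^ 2 * Q (πs k) := by
      have := (hη k).le
      have := hLt (πs k)
      have := hQ0 (πs k)
      gcongr
    have h2 := mul_le_mul_of_nonneg_left (h.trans (add_le_add_right h1 _))
      (show 0 ≤ b / n by positivity)
    refine le_trans (le_of_eq ?_) (h2.trans (le_of_eq ?_))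
    · change η k * (1 / n * _ - 1 / n * _) = _
      rw [xSeq]
      field_simp
    · rw [xSeq]
      field_simp
  have hpath : ∀ πs : ℕ → Equiv.Perm (Fin (b * m)), val πs ≤
      b / (2 * n) * sq (fun t => x0 t - xstar t) +
        ∑ k ∈ Finset.range K, η k ^ 3 * Lt / (b * n) * Q (πs k) := by
    intro πs
    have hjensen : val πs ≤
        ∑ k ∈ Finset.range K, η k * (f (xSeq A ℓ' η πs x0 (k + 1)) - f xstar) := by
      have h := Finset.sum_le_sum fun i (_ : i ∈ Finset.univ) => avg_gap_le hK A ℓ hconv η hη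
        (fun k => xSeq A ℓ' η πs x0 (k + 1)) i
      rw [← Finset.mul_sum, Finset.sum_comm] at h
      have h2 := mul_le_mul_of_nonneg_left h (show 0 ≤ 1 / n by positivity)
      have e : ∑ k ∈ Finset.range K, η k * (f (xSeq A ℓ' η πs x0 (k + 1)) - f xstar) =
          1 / n * ∑ k ∈ Finset.range K, ∑ i, η k * ℓ i (dot (A i) (xSeq A ℓ' η πs x0 (k + 1))) -
            HK * f xstar := by
        simp only [mul_sub, Finset.sum_sub_distrib, HK, Finset.sum_mul]
        congr 1
        rw [Finset.mul_sum]
        refine Finset.sum_congr rfl fun k _ => ?_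
        simp only [f]
        rw [← Finset.mul_sum]
        ring
      rw [e]
      refine le_trans (le_of_eq ?_) (sub_le_sub_right h2 _)
      simp only [val, f, HK]
      ring
    have hs := Finset.sum_le_sum fun k hk => hepoch πs k (Finset.mem_range.1 hk)
    rw [Finset.sum_add_distrib, ← Finset.mul_sum, Finset.sum_range_sub'] at hs
    refine hjensen.trans (hs.trans ?_)
    have h0 : 0 ≤ b / (2 * n) * sq (fun t => xSeq A ℓ' η πs x0 K t - xstar t) :=
      mul_nonneg (by positivity) (sq_nonneg' _)
    rw [mul_sub]
    simp only [xSeq] at h0 ⊢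
    linarith
  have hexp : ∀ {α : Type} [Fintype α] [Nonempty α] (πs : α → ℕ → Equiv.Perm (Fin (b * m))),
      (∀ k < K, Eunif (fun a => Q (πs a k)) = Eunif Q) → Eunif (fun a => val (πs a)) ≤ bnd := by
    intro α _ _ πs hπ
    refine (Eunif_mono fun a => hpath (πs a)).trans (le_of_eq ?_)
    rw [Eunif_add, Eunif_const, Eunif_sum]
    simp only [bnd]
    congr 1
    refine Finset.sum_congr rfl fun k hk => ?_
    rw [Eunif_const_mul, hπ k (Finset.mem_range.1 hk), hEQ, ← mul_assoc]
    congr 1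
    rcases eq_or_ne (n - 1) 0 with h0 | h0
    · simp [h0]
    · field_simp
  refine ⟨hexp (fun g => extSeq g) fun k hk => ?_, hexp (fun π _ => π) fun _ _ => rfl⟩
  have e : (fun g : Fin K → Equiv.Perm (Fin (b * m)) => Q (extSeq g k)) =
      fun g => Q (g ⟨k, hk⟩) := by
    funext g
    rw [extSeq, dif_pos hk]
  rw [e, Eunif_pi_eval]
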